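/- Let G be a finite group containing exactly one element z of order 2, and let A := {1, z} be the unique subgroup of G of order 2 (which is necessarily central). Then for every normalized 3-cocycle ω on G with values in ℂˣ, the subgroup A is ω-admissible: there exists an ω-admissible pair (τ, ν) for A. -/

import Mathlib

/-- Conjugation: `g^x = x⁻¹ * g * x`. -/
def cjg {G : Type*} [Group G] (g x : G) : G := x⁻¹ * g * x

/-- A normalized 3-cocycle on `G` with values in `ℂˣ`. -/
def IsNormalized3Cocycle {G : Type*} [Group G] (ω : G → G → G → ℂˣ) : Prop :=
  (∀ x y z w, ω y z w * ω x (y * z) w * ω x y z = ω (x * y) z w * ω x y (z * w)) ∧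
  (∀ x y z, (x = 1 ∨ y = 1 ∨ z = 1) → ω x y z = 1)

/-- `θ_g(x,y) = ω(g,x,y)·ω(x,y,g^{xy}) / ω(x,g^x,y)`. -/
def theta {G : Type*} [Group G] (ω : G → G → G → ℂˣ) (g x y : G) : ℂˣ :=
  ω g x y * ω x y (cjg g (x * y)) / ω x (cjg g x) y

/-- `γ_g(x,y) = ω(x,y,g)·ω(g,x^g,y^g) / ω(x,g,y^g)`. -/
def gam {G : Type*} [Group G] (ω : G → G → G → ℂˣ) (g x y : G) : ℂˣ :=
  ω x y g * ω g (cjg x g) (cjg y g) / ω x g (cjg y g)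

/-- A 2-coboundary of `G` with values in `ℂˣ`. -/
def Is2Coboundary {G : Type*} [Group G] (β : G → G → ℂˣ) : Prop :=
  ∃ f : G → ℂˣ, f 1 = 1 ∧ ∀ x y, β x y = f x * f y / f (x * y)

/-- A (normalized) 2-cocycle of `G` with values in `ℂˣ`. -/
def Is2Cocycle {G : Type*} [Group G] (β : G → G → ℂˣ) : Prop :=
  (∀ x, β x 1 = 1 ∧ β 1 x = 1) ∧
  (∀ x y z, β x y * β (x * y) z = β y z * β x (y * z))

/-- An ω-admissible pair `(τ, ν)` for a subgroup `A`. -/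
def IsAdmissiblePair {G : Type*} [Group G] (ω : G → G → G → ℂˣ) (A : Subgroup G)
    (τ : A → G → ℂˣ) (ν : A → (G →* ℂˣ)) : Prop :=
  (∀ x, τ 1 x = 1) ∧ (∀ a, τ a 1 = 1) ∧
  (∀ (a : A) (x y : G), theta ω (a : G) x y = τ a x * τ a y / τ a (x * y)) ∧
  (ν 1 = 1) ∧
  (∀ (a b : A) (g : G),
    theta ω g (a : G) (b : G) * (τ a g * τ b g / τ (a * b) g)
      = ν a g * ν b g / ν (a * b) g)

theorem dvd_add_one_of_no_root (k : ℕ) (u j : ℤ) (hj : (2 ^ k : ℤ) ∣ j * (u - 1))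
    (hu : (2 ^ k : ℤ) ∣ u * u - 1) (hu1 : ¬ (2 ^ k : ℤ) ∣ u - 1)
    (hno : ∀ i : ℤ, ¬ (2 ^ k : ℤ) ∣ j + i * (u + 1)) :
    (2 ^ k : ℤ) ∣ u + 1 ∧ (4 : ℤ) ∣ 2 ^ k := by
  have hcop : ∀ v : ℤ, v % 2 = 1 → IsCoprime (2 ^ k : ℤ) v := fun v hv =>
    IsCoprime.pow_left ⟨-(v / 2), 1, by lia⟩
  obtain _ | k := k
  · simp at hu1
  have hodd : u % 2 = 1 := by
    have h2 : (2 : ℤ) ∣ u * u - 1 := (dvd_pow_self 2 k.succ_ne_zero).trans hu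
    rcases Int.emod_two_eq_zero_or_one u with h | h
    · have : (2 : ℤ) ∣ u * u := (Int.dvd_of_emod_eq_zero h).mul_right u
      lia
    · exact h
  obtain _ | k := k
  · exact absurd (by norm_num; lia) hu1
  refine ⟨?_, ⟨2 ^ k, by ring⟩⟩
  have hm : (2 : ℤ) ^ (k + 1 + 1) = 2 * 2 ^ (k + 1) := by ring
  have h4 : u % 4 = 1 ∨ u % 4 = 3 := by lia
  rcases h4 with h4 | h4
  · exfalso
    rcases Int.emod_two_eq_zero_or_one j with h | h
    · obtain ⟨v, hv⟩ : ∃ v, u + 1 = 2 * v := ⟨(u + 1) / 2, by lia⟩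
      obtain ⟨r, s, hrs⟩ := hcop v (by lia)
      obtain ⟨l, hl⟩ := Int.dvd_of_emod_eq_zero h
      refine hno (-(l * s)) ⟨j * r, ?_⟩
      linear_combination (-(l * s)) * hv - j * hrs + (s * v) * hl
    · exact hu1 ((hcop j h).dvd_of_dvd_mul_left hj)
  · obtain ⟨w, hw⟩ : ∃ w, u - 1 = 2 * w := ⟨(u - 1) / 2, by lia⟩
    have hwc := hcop w (by lia)
    have half : ∀ t, (2 ^ (k + 1 + 1) : ℤ) ∣ t * (2 * w) → (2 ^ (k + 1) : ℤ) ∣ t := by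
      intro t ht
      rw [← mul_assoc] at ht
      have h := hwc.dvd_of_dvd_mul_right ht
      rw [hm, mul_comm t] at h
      exact (mul_dvd_mul_iff_left (two_ne_zero' ℤ)).1 h
    obtain ⟨j', hj'⟩ := half j (hw ▸ hj)
    obtain ⟨u', hu'⟩ := half (u + 1) (by rw [← hw]; convert hu using 1; ring)
    rcases Int.emod_two_eq_zero_or_one u' with h | h
    · obtain ⟨l, rfl⟩ := Int.dvd_of_emod_eq_zero h
      exact ⟨l, by rw [hu']; ring⟩
    · exfalso
      rcases Int.emod_two_eq_zero_or_one j' with h' | h'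
      · obtain ⟨l, rfl⟩ := Int.dvd_of_emod_eq_zero h'
        exact hno 0 ⟨l, by rw [hj']; ring⟩
      · obtain ⟨l, hl⟩ : ∃ l, j' + u' = 2 * l := ⟨(j' + u') / 2, by lia⟩
        exact hno 1 ⟨l, by rw [hj', hu', hm]; linear_combination 2 ^ (k + 1) * hl⟩

open Subgroup in
theorem IsPGroup.exists_commutator_mem {S : Type*} [Group S] [Finite S] {p : ℕ} [Fact p.Prime]
    (hS : IsPGroup p S) (A C : Subgroup S) [C.Normal] (hCA : ¬ C ≤ A) :
    ∃ x ∈ C, x ∉ A ∧ x ^ p ∈ A ∧ ∀ g, x * g * x⁻¹ * g⁻¹ ∈ A := by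
  classical
  have hL : ∃ i, (⊤ : Subgroup S).lowerCentralSeries i ⊓ C ≤ A := by
    obtain ⟨n, hn⟩ := Subgroup.nilpotent_iff_lowerCentralSeries.1 hS.isNilpotent
    exact ⟨n, by simp [hn]⟩
  obtain ⟨i, hi⟩ : ∃ i, Nat.find hL = i + 1 := Nat.exists_eq_succ_of_ne_zero fun h => hCA <| by
    simpa [h] using Nat.find_spec hL
  have hmin := Nat.find_min hL (by lia : i < Nat.find hL)
  have hspec := Nat.find_spec hL
  rw [hi] at hspec
  obtain ⟨x, ⟨hxL, hxC⟩, hxA⟩ := SetLike.not_le_iff_exists.1 hmin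
  have hP : ∃ k, x ^ p ^ k ∈ A := by
    obtain ⟨k, hk⟩ := hS x
    exact ⟨k, hk ▸ A.one_mem⟩
  obtain ⟨k, hk⟩ : ∃ k, Nat.find hP = k + 1 := Nat.exists_eq_succ_of_ne_zero fun h => hxA <| by
    simpa [h] using Nat.find_spec hP
  refine ⟨x ^ p ^ k, C.pow_mem hxC _, Nat.find_min hP (by lia : k < Nat.find hP), ?_, fun g => ?_⟩
  · rw [← pow_mul, ← pow_succ, ← hk]
    exact Nat.find_spec hP
  · refine hspec ⟨commutator_mem_commutator (pow_mem hxL _) (mem_top g), ?_⟩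
    rw [mul_assoc, mul_assoc]
    refine C.mul_mem (C.pow_mem hxC _) ?_
    rw [← mul_assoc]
    exact ‹C.Normal›.conj_mem _ (C.inv_mem (C.pow_mem hxC _)) g

section UniqueInvolution

variable {S : Type*} [Group S] [Finite S] {z : S}

open Subgroup

/-- A finite 2-group with a unique involution has a normal cyclic subgroup which is its own
centralizer. -/
theorem IsPGroup.exists_selfCentralizing_zpowers (hS : IsPGroup 2 S) (hz2 : z * z = 1)
    (hz1 : z ≠ 1) (huniq : ∀ w : S, w * w = 1 → w ≠ 1 → w = z) :
    ∃ a : S, (zpowers a).Normal ∧ z ∈ zpowers a ∧ ∀ x, Commute x a → x ∈ zpowers a := by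
  have hzc : ∀ g : S, g * z * g⁻¹ = z := fun g => huniq _
    (by rw [show g * z * g⁻¹ * (g * z * g⁻¹) = g * (z * z) * g⁻¹ by group, hz2]; group)
    (by rwa [Ne, conj_eq_one_iff])
  obtain ⟨a, ha, hmax⟩ := Set.Finite.exists_maximalFor orderOf {a : S | (zpowers a).Normal}
    (Set.toFinite _) ⟨1, by simp only [Set.mem_ofPred_eq, zpowers_one_eq_bot]; infer_instance⟩
  have hzn : (zpowers z).Normal := ⟨fun n hn g => by
    obtain ⟨k, rfl⟩ := hn
    exact ⟨k, by simp only [← conj_zpow, hzc]⟩⟩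
  have hzo : orderOf z = 2 := orderOf_eq_prime (by rw [pow_two, hz2]) hz1
  obtain ⟨k, hk⟩ := IsPGroup.iff_orderOf.1 hS a
  obtain _ | k := k
  · have := hmax hzn
    rw [hzo, hk] at this
    simp at this
  have hza : z ∈ zpowers a := by
    refine ⟨((2 ^ k : ℕ) : ℤ), huniq _ ?_ ?_⟩
    · simp only [zpow_natCast]
      rw [← pow_add, ← two_mul, ← pow_succ', ← hk, pow_orderOf_eq_one]
    · simp only [zpow_natCast]
      refine pow_ne_one_of_lt_orderOf (by positivity) ?_
      rw [hk]
      exact Nat.pow_lt_pow_right (by norm_num) (Nat.lt_succ_self k)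
  have hinv : ∀ w : S, w * w = 1 → w ∈ zpowers a := fun w hw => by
    by_cases h : w = 1
    · exact h ▸ one_mem _
    · exact huniq w hw h ▸ hza
  refine ⟨a, ha, hza, fun x hx => ?_⟩
  have : (zpowers a).Normal := ha
  by_contra hxa
  obtain ⟨x, hxC, hxA, hx2, hxcomm⟩ := hS.exists_commutator_mem (zpowers a)
    (centralizer (zpowers a : Set S)) fun h => hxa <| h <| mem_centralizer_iff.2 fun b hb => by
      obtain ⟨i, rfl⟩ := hb
      exact (hx.zpow_right i).symm.eq
  have hxa' : Commute x a := (mem_centralizer_iff.1 hxC a (mem_zpowers a)).symm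
  obtain ⟨j, hj⟩ := hx2
  simp only at hj
  rcases Int.even_or_odd' j with ⟨l, rfl | rfl⟩
  · refine hxA ?_
    have h := hinv (x * a ^ (-l)) <| by
      rw [(hxa'.zpow_right (-l)).symm.mul_mul_mul_comm, ← pow_two, ← hj, ← zpow_add, ← zpow_add]
      simp [show 2 * l + (-l + -l) = 0 by ring]
    simpa using mul_mem h (zpow_mem (mem_zpowers a) l)
  · obtain ⟨r, s, hrs⟩ : IsCoprime ((2 : ℤ) ^ (k + 1)) (2 * l + 1) :=
      IsCoprime.pow_left ⟨-l, 1, by ring⟩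
    have hax : a ∈ zpowers x := by
      refine ⟨2 * s, ?_⟩
      have h1 : a ^ ((2 : ℤ) ^ (k + 1)) = 1 := orderOf_dvd_iff_zpow_eq_one.1 (by simp [hk])
      simp only
      rw [zpow_mul, zpow_ofNat, ← hj, ← zpow_mul, mul_comm _ s, ← one_mul (a ^ _),
        ← one_zpow r, ← h1, ← zpow_mul, ← zpow_add, mul_comm _ r, hrs, zpow_one]
    have hle : zpowers a ≤ zpowers x := zpowers_le.2 hax
    have hxn : (zpowers x).Normal := ⟨fun n hn g => by
      obtain ⟨i, rfl⟩ := hn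
      simp only [← conj_zpow]
      refine zpow_mem ?_ i
      have := mul_mem (inv_mem (hle (hxcomm g))) (mem_zpowers x)
      convert this using 1
      group⟩
    have h1 := hmax hxn (orderOf_dvd_of_mem_zpowers hax |> Nat.le_of_dvd (orderOf_pos x))
    refine hxA ?_
    rw [Subgroup.eq_of_le_of_card_ge hle (by simpa [Nat.card_zpowers] using h1)]
    exact mem_zpowers x

/-- A finite 2-group with a unique involution is cyclic or generalized quaternion. -/
theorem IsPGroup.cyclic_or_quaternion_of_unique_involution (hS : IsPGroup 2 S) (hz2 : z * z = 1)
    (hz1 : z ≠ 1) (huniq : ∀ w : S, w * w = 1 → w ≠ 1 → w = z) :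
    ∃ a : S, z ∈ zpowers a ∧ ((∀ g, g ∈ zpowers a) ∨
      4 ∣ orderOf a ∧ ∃ y, y ∉ zpowers a ∧ y * y ∈ zpowers a ∧ y⁻¹ * a * y = a⁻¹ ∧
        ∀ g, g ∈ zpowers a ∨ g * y⁻¹ ∈ zpowers a) := by
  classical
  obtain ⟨a, ha, hza, hcent⟩ := hS.exists_selfCentralizing_zpowers hz2 hz1 huniq
  refine ⟨a, hza, or_iff_not_imp_left.2 fun hall => ?_⟩
  have hinv : ∀ w : S, w * w = 1 → w ∈ zpowers a := fun w hw => by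
    by_cases h : w = 1
    · exact h ▸ one_mem _
    · exact huniq w hw h ▸ hza
  obtain ⟨k, hk⟩ := IsPGroup.iff_orderOf.1 hS a
  have hdvd : ∀ i : ℤ, (2 ^ k : ℤ) ∣ i ↔ a ^ i = 1 := fun i => by
    rw [← orderOf_dvd_iff_zpow_eq_one, hk]; simp
  have hconj : ∀ y, ∃ u : ℤ, a ^ u = y⁻¹ * a * y ∧ ∀ i : ℤ, y⁻¹ * a ^ i * y = a ^ (u * i) := by
    intro y
    obtain ⟨u, hu⟩ := ha.conj_mem' a (mem_zpowers a) y
    refine ⟨u, hu, fun i => ?_⟩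
    simp only at hu
    rw [zpow_mul, hu]
    simpa using (conj_zpow (i := i) (a := y⁻¹) (b := a)).symm
  have hinverts : ∀ y, y ∉ zpowers a → y * y ∈ zpowers a →
      y⁻¹ * a * y = a⁻¹ ∧ (4 : ℤ) ∣ 2 ^ k := by
    intro y hy hy2
    obtain ⟨j, hj⟩ := hy2
    obtain ⟨u, hu, hui⟩ := hconj y
    simp only at hj
    have h := dvd_add_one_of_no_root k u j ?_ ?_ ?_ ?_
    · refine ⟨?_, h.2⟩
      rw [← hu]
      exact eq_inv_of_mul_eq_one_left (by rw [← zpow_add_one]; exact (hdvd _).1 h.1)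
    · rw [hdvd, mul_sub, mul_one, zpow_sub, mul_comm j, ← hui, hj]
      group
    · rw [hdvd, zpow_sub, ← hui, hu, zpow_one,
        show y⁻¹ * (y⁻¹ * a * y) * y = (y * y)⁻¹ * a * (y * y) by group, ← hj]
      group
    · rw [hdvd, zpow_sub, hu, zpow_one, mul_inv_eq_one]
      intro h
      refine hy (hcent y ?_)
      calc y * a = y * (y⁻¹ * a * y) := by rw [h]
        _ = a * y := by group
    · intro i hi
      rw [hdvd] at hi
      refine hy ?_
      have := hinv (y * a ^ i) <| by
        rw [show y * a ^ i * (y * a ^ i) = y * y * (y⁻¹ * a ^ i * y) * a ^ i by group, hui, ← hj,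
          ← zpow_add, ← zpow_add, ← hi]
        congr 1; ring
      simpa using mul_mem this (zpow_mem (mem_zpowers a) (-i))
  have hsq : ∀ w, w ∉ zpowers a → w * w ∈ zpowers a := by
    intro w hw
    have hP : ∃ t, w ^ 2 ^ t ∈ zpowers a := by
      obtain ⟨t, ht⟩ := hS w
      exact ⟨t, ht ▸ one_mem _⟩
    have hspec := Nat.find_spec hP
    have hmin := fun m => @Nat.find_min _ _ hP m
    generalize Nat.find hP = t at hspec hmin
    obtain _ | _ | t := t
    · exact absurd (by simpa using hspec) hw
    · simpa [pow_two] using hspec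
    exfalso
    have h1 := hmin (t + 1) (by lia)
    have hw1 : w ^ 2 ^ (t + 1) = w ^ 2 ^ t * w ^ 2 ^ t := by rw [← pow_add]; congr 1; ring
    have hw2 : w ^ 2 ^ (t + 1 + 1) = w ^ 2 ^ (t + 1) * w ^ 2 ^ (t + 1) := by
      rw [← pow_add]; congr 1; ring
    obtain ⟨h2, h4⟩ := hinverts _ h1 (hw2 ▸ hspec)
    obtain ⟨v, hv, hvi⟩ := hconj (w ^ 2 ^ t)
    rw [hw1, show ∀ b c : S, (b * b)⁻¹ * c * (b * b) = b⁻¹ * (b⁻¹ * c * b) * b by intros; group,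
      ← hv, hvi] at h2
    have h3 : (2 ^ k : ℤ) ∣ v * v + 1 := by
      rw [hdvd, zpow_add, h2]; simp
    have h5 := h4.trans h3
    have h6 : v % 4 = 0 ∨ v % 4 = 1 ∨ v % 4 = 2 ∨ v % 4 = 3 := by lia
    have h7 := Int.emod_eq_zero_of_dvd h5
    rcases h6 with h | h | h | h <;> simp [Int.add_emod, Int.mul_emod, h] at h7
  push Not at hall
  obtain ⟨y, hy⟩ := hall
  obtain ⟨hya, h4⟩ := hinverts y hy (hsq y hy)
  refine ⟨by rw [hk]; exact_mod_cast h4, y, hy, hsq y hy, hya, fun g => ?_⟩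
  refine or_iff_not_imp_left.2 fun hg => hcent _ ?_
  obtain ⟨hga, -⟩ := hinverts g hg (hsq g hg)
  have : g⁻¹ * a * g = y⁻¹ * a * y := hga.trans hya.symm
  calc g * y⁻¹ * a = g * (y⁻¹ * a * y) * y⁻¹ := by group
    _ = a * (g * y⁻¹) := by rw [← this]; group

end UniqueInvolution

section DoubleCover

variable {K G : Type*} [Group K] [Group G] {π : K →* G} {ε : K} {z : G}

open Subgroup

theorem exists_sign_of_complement (hε : ε * ε = 1) (hker : ∀ k, π k = 1 → k = 1 ∨ k = ε)
    (H : Subgroup K) (hH : ε ∉ H) (hsurj : ∀ k, ∃ h ∈ H, π h = π k) :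
    ∃ V : K →* ℤˣ, V ε = -1 := by
  classical
  have h2 : H.index = 2 := by
    refine index_eq_two_iff.2 ⟨ε, fun b => ?_⟩
    by_cases hb : b ∈ H
    · exact Or.inr ⟨hb, fun h => hH ((H.mul_mem_cancel_left hb).1 h)⟩
    · obtain ⟨h, hh, hhb⟩ := hsurj b
      rcases hker (h⁻¹ * b) (by simp [hhb]) with h1 | h1
      · exact absurd (by rwa [← inv_mul_eq_one.1 h1]) hb
      · refine Or.inl ⟨?_, hb⟩
        rwa [eq_mul_of_inv_mul_eq h1, mul_assoc, hε, mul_one]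
  refine ⟨MonoidHom.mk' (fun k => if k ∈ H then 1 else -1) fun a b => ?_, by simp [hH]⟩
  simp only [mul_mem_iff_of_index_two h2]
  by_cases ha : a ∈ H <;> by_cases hb : b ∈ H <;> simp [ha, hb]

/-- A double cover of a finite 2-group with unique involution `z` splits as soon as `z` lifts to
involutions and every inversion of an element having `z` as a power lifts to an inversion. -/
theorem IsPGroup.exists_sign_of_unique_involution [Finite G] (hG : IsPGroup 2 G)
    (hz2 : z * z = 1) (hz1 : z ≠ 1) (huniq : ∀ w : G, w * w = 1 → w ≠ 1 → w = z)
    (hπ : Function.Surjective π) (hε1 : ε ≠ 1) (hε : ε * ε = 1) (hπε : π ε = 1)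
    (hker : ∀ k, π k = 1 → k = 1 ∨ k = ε) (hlift : ∀ k, π k = z → k * k = 1)
    (hinv : ∀ k l, z ∈ zpowers (π k) → π (l⁻¹ * k * l) = π k⁻¹ → l⁻¹ * k * l = k⁻¹) :
    ∃ V : K →* ℤˣ, V ε = -1 := by
  obtain ⟨a, hza, hstruct⟩ := hG.cyclic_or_quaternion_of_unique_involution hz2 hz1 huniq
  obtain ⟨b, rfl⟩ := hπ a
  have hzo : orderOf z = 2 := orderOf_eq_prime (by rw [pow_two, hz2]) hz1
  have hpow : ∀ m, orderOf (π b) = 2 * m → π b ^ m = z := fun m hm => by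
    have hpos := hm ▸ orderOf_pos (π b)
    refine huniq _ ?_ (pow_ne_one_of_lt_orderOf (by lia) (by lia))
    rw [← pow_add, ← two_mul, ← hm, pow_orderOf_eq_one]
  obtain ⟨m, hm⟩ : 2 ∣ orderOf (π b) := hzo ▸ orderOf_dvd_of_mem_zpowers hza
  have hεb : ε ∉ zpowers b := by
    rintro ⟨i, hi⟩
    simp only at hi
    have hb1 : b ^ (2 * m) = 1 := by
      rw [two_mul, pow_add]
      exact hlift _ (by rw [map_pow, hpow m hm])
    obtain ⟨r, hr⟩ : (orderOf (π b) : ℤ) ∣ i :=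
      orderOf_dvd_iff_zpow_eq_one.2 (by rw [← map_zpow, hi, hπε])
    rw [hr, hm, zpow_mul, zpow_natCast, hb1, one_zpow] at hi
    exact hε1 hi.symm
  rcases hstruct with hall | ⟨h4, y, hy, hyy, hya, hall⟩
  · refine exists_sign_of_complement hε hker (zpowers b) hεb fun k => ?_
    obtain ⟨i, hi⟩ := hall (π k)
    exact ⟨b ^ i, ⟨i, rfl⟩, by simpa using hi⟩
  obtain ⟨c, rfl⟩ := hπ y
  obtain ⟨r, hr⟩ : ∃ r, m = 2 * r := ⟨m / 2, by lia⟩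
  have hzr : π b ^ r * π b ^ r = z := by rw [← pow_add, ← two_mul, ← hr, hpow m hm]
  have hyb : ∀ i : ℤ, (π c)⁻¹ * π b ^ i * π c = (π b ^ i)⁻¹ := fun i => by
    have := conj_zpow (i := i) (a := (π c)⁻¹) (b := π b)
    rw [inv_inv, hya] at this
    rw [← this, inv_zpow]
  have hyz : π c * π c = z := by
    obtain ⟨j, hj⟩ := hyy
    simp only at hj
    have h := hyb j
    rw [hj, show (π c)⁻¹ * (π c * π c) * π c = π c * π c by group] at h
    refine huniq _ (mul_eq_one_iff_eq_inv.2 h) fun h1 => hy ?_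
    by_cases hc : π c = 1
    · exact hc ▸ one_mem _
    · exact huniq _ h1 hc ▸ hza
  have hcb : c⁻¹ * b * c = b⁻¹ := hinv b c hza (by simpa using hya)
  have hbc : ∀ i : ℤ, c * b ^ i = b ^ (-i) * c := fun i => by
    have := conj_zpow (i := -i) (a := c⁻¹) (b := b)
    rw [inv_inv, hcb, inv_zpow', neg_neg] at this
    rw [this]
    group
  have hdc : (b ^ r)⁻¹ * c * b ^ r = c⁻¹ := by
    refine hinv c (b ^ r) ⟨2, by simp only; rw [zpow_ofNat, pow_two, hyz]⟩ ?_
    have h := hyb (-r)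
    simp only [zpow_neg, zpow_natCast, inv_inv] at h
    simp only [map_mul, map_inv, map_pow]
    rw [show (π b ^ r)⁻¹ * π c * π b ^ r = π c * ((π c)⁻¹ * (π b ^ r)⁻¹ * π c) * π b ^ r by group,
      h, mul_assoc, hzr, eq_inv_iff_mul_eq_one, mul_assoc, ← hyz]
    rw [show π c * (π c * π c * π c) = (π c * π c) * (π c * π c) by group, hyz, hz2]
  have hcc : c * c ∈ zpowers b := by
    have h := hbc r
    rw [zpow_neg, zpow_natCast] at h
    refine ⟨r + r, ?_⟩
    rw [mul_assoc, h, ← mul_assoc, ← zpow_natCast, ← zpow_neg, ← zpow_add] at hdc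
    have h' := mul_eq_one_iff_eq_inv.2 hdc
    rw [mul_assoc, mul_eq_one_iff_inv_eq, ← zpow_neg] at h'
    rw [← h']
    congr 1
    ring
  let H : Subgroup K :=
    { carrier := {k | ∃ i : ℤ, k = b ^ i ∨ k = b ^ i * c}
      one_mem' := ⟨0, by simp⟩
      mul_mem' := by
        obtain ⟨s, hs⟩ := hcc
        simp only at hs
        rintro _ _ ⟨i, rfl | rfl⟩ ⟨j, rfl | rfl⟩
        · exact ⟨i + j, Or.inl (zpow_add b i j).symm⟩
        · exact ⟨i + j, Or.inr (by rw [zpow_add, mul_assoc])⟩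
        · exact ⟨i - j, Or.inr (by rw [mul_assoc, hbc, ← mul_assoc, ← zpow_add, sub_eq_add_neg])⟩
        · refine ⟨i - j + s, Or.inl ?_⟩
          rw [mul_assoc, ← mul_assoc c, hbc, mul_assoc, ← hs, ← zpow_add, ← zpow_add]
          congr 1
          ring
      inv_mem' := by
        obtain ⟨s, hs⟩ := hcc
        simp only at hs
        rintro _ ⟨i, rfl | rfl⟩
        · exact ⟨-i, Or.inl (zpow_neg b i).symm⟩
        · refine ⟨i + s, Or.inr ?_⟩
          rw [inv_eq_iff_mul_eq_one, mul_assoc, ← mul_assoc c, hbc, mul_assoc, ← hs, ← zpow_add,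
            ← zpow_add]
          simp }
  refine exists_sign_of_complement hε hker H ?_ fun k => ?_
  · rintro ⟨i, h | h⟩
    · exact hεb ⟨i, h.symm⟩
    · have h := congrArg π h
      rw [hπε, map_mul, map_zpow] at h
      exact hy ⟨-i, by simp only; rw [zpow_neg]; exact inv_eq_of_mul_eq_one_right h.symm⟩
  · rcases hall (π k) with ⟨i, hi⟩ | ⟨i, hi⟩
    · exact ⟨b ^ i, ⟨i, Or.inl rfl⟩, by simpa using hi⟩
    · exact ⟨b ^ i * c, ⟨i, Or.inr rfl⟩, by rw [map_mul, map_zpow]; exact mul_eq_of_eq_mul_inv hi⟩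

/-- A double cover of a finite group with unique involution `z` splits as soon as `z` lifts to
involutions and every inversion of an element having `z` as a power lifts to an inversion. -/
theorem exists_sign_of_unique_involution [Finite G]
    (hz2 : z * z = 1) (hz1 : z ≠ 1) (huniq : ∀ w : G, w * w = 1 → w ≠ 1 → w = z)
    (hπ : Function.Surjective π) (hε1 : ε ≠ 1) (hε : ε * ε = 1) (hπε : π ε = 1)
    (hker : ∀ k, π k = 1 → k = 1 ∨ k = ε) (hlift : ∀ k, π k = z → k * k = 1)
    (hinv : ∀ k l, z ∈ zpowers (π k) → π (l⁻¹ * k * l) = π k⁻¹ → l⁻¹ * k * l = k⁻¹) :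
    ∃ V : K →* ℤˣ, V ε = -1 := by
  have hzo : orderOf z = 2 := orderOf_eq_prime (by rw [pow_two, hz2]) hz1
  have hzP : IsPGroup 2 (zpowers z) := IsPGroup.of_card (n := 1) (by simp [hzo])
  obtain ⟨P, hP⟩ := hzP.exists_le_sylow
  have hzP : z ∈ P := hP (mem_zpowers z)
  let H : Subgroup K := (P : Subgroup G).comap π
  have hHi : H.index = (P : Subgroup G).index := index_comap_of_surjective _ hπ
  have : H.FiniteIndex := ⟨hHi ▸ FiniteIndex.index_ne_zero⟩
  have hεH : ε ∈ H := by simp [H, hπε]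
  have hodd : Odd H.index := by
    rw [hHi, ← Nat.not_even_iff_odd, even_iff_two_dvd]
    exact P.not_dvd_index
  obtain ⟨V, hV⟩ := IsPGroup.exists_sign_of_unique_involution
    (π := π.subgroupComap (P : Subgroup G)) (ε := ⟨ε, hεH⟩) (z := ⟨z, hzP⟩) P.isPGroup' (Subtype.ext hz2)
    (fun h => hz1 (congrArg Subtype.val h))
    (fun w hw hw1 => Subtype.ext (huniq w (congrArg Subtype.val hw) fun h => hw1 (Subtype.ext h)))
    (π.subgroupComap_surjective_of_surjective _ hπ)
    (fun h => hε1 (congrArg Subtype.val h)) (Subtype.ext hε) (Subtype.ext hπε)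
    (fun k hk => (hker k (congrArg Subtype.val hk)).imp Subtype.ext Subtype.ext)
    (fun k hk => Subtype.ext (hlift k (congrArg Subtype.val hk)))
    (fun k l hk hkl => Subtype.ext <| hinv k l
      (let ⟨i, hi⟩ := hk; ⟨i, congrArg Subtype.val hi⟩) (congrArg Subtype.val hkl))
  refine ⟨V.transfer, ?_⟩
  have hcentral : ∀ g : K, g⁻¹ * ε * g = ε := fun g =>
    (hker _ (by simp [hπε])).resolve_left fun h => hε1 (by
      rwa [mul_assoc, inv_mul_eq_one, right_eq_mul] at h)
  rw [MonoidHom.transfer_eq_pow V ε fun k g _ => ?_]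
  · convert hV using 2
    refine Subtype.ext ?_
    simp only
    obtain ⟨n, hn⟩ := hodd
    rw [hn, pow_succ, pow_mul, pow_two, hε, one_pow, one_mul]
  · have := conj_pow (i := k) (a := g⁻¹) (b := ε)
    rw [inv_inv, hcentral] at this
    exact this.symm

end DoubleCover

section Cocycle

variable {G : Type*} [Group G] {ω : G → G → G → ℂˣ}

theorem cjg_eq {g x g' : G} (h : g * x = x * g') : cjg g x = g' := by
  rw [cjg, mul_assoc, h, inv_mul_cancel_left]

theorem theta_eq (ω : G → G → G → ℂˣ) {g x y g' g'' : G} (hx : g * x = x * g')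
    (hy : g' * y = y * g'') : theta ω g x y = ω g x y * ω x y g'' / ω x g' y := by
  rw [theta, cjg_eq hx, cjg_eq (g' := g'') (by rw [← mul_assoc, hx, mul_assoc, hy, mul_assoc])]

theorem gam_eq (ω : G → G → G → ℂˣ) {g x y x' y' : G} (hx : x * g = g * x') (hy : y * g = g * y') :
    gam ω g x y = ω x y g * ω g x' y' / ω x g y' := by
  rw [gam, cjg_eq hx, cjg_eq hy]

namespace IsNormalized3Cocycle

theorem ofMul_eq (hω : IsNormalized3Cocycle ω) (x y z w : G) {p q r : G} (hp : x * y = p)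
    (hq : y * z = q) (hr : z * w = r) :
    Additive.ofMul (ω y z w) + Additive.ofMul (ω x q w) + Additive.ofMul (ω x y z) =
      Additive.ofMul (ω p z w) + Additive.ofMul (ω x y r) := by
  subst hp hq hr
  exact congrArg Additive.ofMul (hω.1 x y z w)

theorem theta_cocycle (hω : IsNormalized3Cocycle ω) {g x y w g₁ g₂ g₃ : G} (h₁ : g * x = x * g₁)
    (h₂ : g₁ * y = y * g₂) (h₃ : g₂ * w = w * g₃) :
    theta ω g x y * theta ω g (x * y) w = theta ω g x (y * w) * theta ω g₁ y w := by
  rw [theta_eq ω h₁ h₂, theta_eq ω h₂ h₃,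
    theta_eq ω (g' := g₂) (by rw [← mul_assoc, h₁, mul_assoc, h₂, mul_assoc]) h₃,
    theta_eq ω (g'' := g₃) h₁ (by rw [← mul_assoc, h₂, mul_assoc, h₃, mul_assoc])]
  apply Additive.ofMul.injective
  simp only [ofMul_mul, ofMul_div]
  have e₁ := hω.ofMul_eq g x y w h₁ rfl rfl
  have e₂ := hω.ofMul_eq x g₁ y w rfl h₂ rfl
  have e₃ := hω.ofMul_eq x y g₂ w rfl rfl h₃
  have e₄ := hω.ofMul_eq x y w g₃ rfl rfl rfl
  linear_combination (norm := abel) e₁ - e₂ + e₃ - e₄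

theorem theta_mul_theta (hω : IsNormalized3Cocycle ω) {x x' h k x₁ x₂ x₁' x₂' : G}
    (h₁ : x * h = h * x₁) (h₂ : x₁ * k = k * x₂) (h₁' : x' * h = h * x₁')
    (h₂' : x₁' * k = k * x₂') :
    theta ω x h k * theta ω x' h k * (gam ω h x x' * gam ω k x₁ x₁') =
      theta ω (x * x') h k * gam ω (h * k) x x' := by
  have h₁₂ : x * (h * k) = h * k * x₂ := by rw [← mul_assoc, h₁, mul_assoc, h₂, mul_assoc]
  have h₁₂' : x' * (h * k) = h * k * x₂' := by rw [← mul_assoc, h₁', mul_assoc, h₂', mul_assoc]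
  rw [theta_eq ω h₁ h₂, theta_eq ω h₁' h₂', gam_eq ω h₁ h₁', gam_eq ω h₂ h₂', gam_eq ω h₁₂ h₁₂',
    theta_eq ω (g' := x₁ * x₁') (g'' := x₂ * x₂')
      (by rw [mul_assoc, h₁', ← mul_assoc, h₁, mul_assoc])
      (by rw [mul_assoc, h₂', ← mul_assoc, h₂, mul_assoc])]
  apply Additive.ofMul.injective
  simp only [ofMul_mul, ofMul_div]
  have e₁ := hω.ofMul_eq x x' h k rfl h₁' rfl
  have e₂ := hω.ofMul_eq x h x₁' k h₁ rfl h₂'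
  have e₃ := hω.ofMul_eq h x₁ x₁' k rfl rfl h₂'
  have e₄ := hω.ofMul_eq x h k x₂' h₁ rfl rfl
  have e₅ := hω.ofMul_eq h x₁ k x₂' rfl h₂ rfl
  have e₆ := hω.ofMul_eq h k x₂ x₂' rfl rfl rfl
  linear_combination (norm := abel) e₁ - e₂ + e₃ + e₄ - e₅ + e₆

theorem theta_one_left (hω : IsNormalized3Cocycle ω) (x y : G) : theta ω 1 x y = 1 := by
  rw [theta_eq ω (g' := 1) (g'' := 1) (by simp) (by simp), hω.2 _ _ _ (.inl rfl),
    hω.2 _ _ _ (.inr (.inr rfl)), hω.2 _ _ _ (.inr (.inl rfl)), mul_one, div_one]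

theorem theta_one_mid (hω : IsNormalized3Cocycle ω) (g x : G) : theta ω g 1 x = 1 := by
  rw [theta, hω.2 _ _ _ (.inr (.inl rfl)), hω.2 _ _ _ (.inl rfl), hω.2 _ _ _ (.inl rfl), mul_one,
    div_one]

theorem theta_one_right (hω : IsNormalized3Cocycle ω) (g x : G) : theta ω g x 1 = 1 := by
  rw [theta, hω.2 _ _ _ (.inr (.inr rfl)), hω.2 _ _ _ (.inr (.inl rfl)),
    hω.2 _ _ _ (.inr (.inr rfl)), mul_one, div_one]

theorem gam_one (hω : IsNormalized3Cocycle ω) (x y : G) : gam ω 1 x y = 1 := by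
  rw [gam, hω.2 _ _ _ (.inl rfl), hω.2 _ _ _ (.inr (.inl rfl)),
    hω.2 _ _ _ (.inr (.inr rfl)), mul_one, div_one]

end IsNormalized3Cocycle

theorem theta_self_left (ω : G → G → G → ℂˣ) {x y x' : G} (h : x * y = y * x') :
    theta ω x x y = ω x y x' := by
  rw [theta_eq ω rfl h, mul_div_cancel_left]

theorem theta_self_right (ω : G → G → G → ℂˣ) {x y x' : G} (h : x * y = y * x') :
    theta ω x y x' = ω x y x' := by
  rw [theta_eq ω h rfl, mul_div_cancel_right]

theorem gam_eq_theta (ω : G → G → G → ℂˣ) {z x y : G} (hx : x * z = z * x) (hy : y * z = z * y) :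
    gam ω z x y = theta ω z x y := by
  rw [gam_eq ω hx hy, theta_eq ω hx.symm hy.symm, mul_comm (ω x y z)]

/-- The product `ω(x,1,x)·ω(x,x,x)·⋯·ω(x,x^{n-1},x)`. -/
def powProd (ω : G → G → G → ℂˣ) (x : G) (n : ℕ) : ℂˣ :=
  ∏ i ∈ Finset.range n, ω x (x ^ i) x

namespace IsNormalized3Cocycle

theorem theta_pow_mul_powProd (hω : IsNormalized3Cocycle ω) {x y x' : G} (h : x * y = y * x')
    (n : ℕ) : theta ω x (x ^ n) y * powProd ω x n = theta ω x y (x' ^ n) * powProd ω x' n := by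
  induction n with
  | zero => simp [powProd, hω.theta_one_mid, hω.theta_one_right]
  | succ n ih =>
    have hx : x * x ^ n = x ^ n * x := (pow_mul_comm' x n).symm
    have hx' : x' * x' ^ n = x' ^ n * x' := (pow_mul_comm' x' n).symm
    have hn : x ^ n * y = y * x' ^ n :=
      (SemiconjBy.pow_right (show SemiconjBy y x' x from h.symm) n).symm
    have e₁ := hω.theta_cocycle hx rfl h
    have e₂ := hω.theta_cocycle hx h rfl
    have e₃ := hω.theta_cocycle h hx' rfl
    have e₄ := (theta_self_left ω h).trans (theta_self_right ω h).symm
    rw [theta_self_right ω hx] at e₁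
    rw [theta_self_right ω hx'] at e₃
    rw [← h] at e₂
    rw [← hn] at e₃
    rw [powProd, powProd, Finset.prod_range_succ, Finset.prod_range_succ, ← powProd, ← powProd,
      pow_succ, pow_succ]
    replace ih := congrArg Additive.ofMul ih
    replace e₁ := congrArg Additive.ofMul e₁
    replace e₂ := congrArg Additive.ofMul e₂
    replace e₃ := congrArg Additive.ofMul e₃
    replace e₄ := congrArg Additive.ofMul e₄
    apply Additive.ofMul.injective
    simp only [ofMul_mul] at *
    linear_combination (norm := abel) ih + e₁ - e₂ + e₃ + e₄

theorem mul_self_eq_one (hω : IsNormalized3Cocycle ω) (x : G) :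
    ω x x⁻¹ x * ω x⁻¹ x x⁻¹ = 1 := by
  have := hω.1 x x⁻¹ x x⁻¹
  simpa [hω.2, mul_comm] using this

theorem powProd_inv (hω : IsNormalized3Cocycle ω) (x : G) (n : ℕ) :
    powProd ω x⁻¹ n =
      powProd ω x n * (gam ω (x ^ n)⁻¹ x x⁻¹ * theta ω x (x ^ n)⁻¹ (x ^ n)) := by
  induction n with
  | zero => simp [powProd, hω.theta_one_mid, hω.gam_one]
  | succ n ih =>
    set h := x ^ n with hh
    have c : Commute x h := Commute.self_pow x n
    have ck : Commute x h⁻¹ := c.inv_right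
    have e₁ := hω.theta_cocycle (g := x) (x := h⁻¹) (y := x⁻¹) (w := x * h) (g₁ := x) (g₂ := x)
      (g₃ := x) ck (by simp) (by rw [mul_assoc, c.eq])
    have e₂ := hω.theta_cocycle (g := x) (x := x⁻¹) (y := x) (w := h) (g₁ := x) (g₂ := x)
      (g₃ := x) (by simp) rfl c
    have e₃ := hω.theta_mul_theta (x := x) (x' := x⁻¹) (h := h⁻¹) (k := x⁻¹) (x₁ := x) (x₂ := x)
      (x₁' := x⁻¹) (x₂' := x⁻¹) ck (by simp) ck.inv_left rfl
    have e₄ := hω.mul_self_eq_one x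
    rw [theta_self_left ω c, inv_mul_cancel, hω.theta_one_mid,
      theta_self_right ω (x := x) (x' := x) (y := x⁻¹) (by simp)] at e₂
    rw [mul_inv_cancel, hω.theta_one_left, theta_self_right ω (x := x⁻¹) (x' := x⁻¹) ck.inv_left,
      gam_eq ω (g := x⁻¹) (x := x) (y := x⁻¹) (x' := x) (y' := x⁻¹) (by simp) rfl] at e₃
    rw [inv_mul_cancel_left] at e₁
    rw [powProd, powProd, Finset.prod_range_succ, Finset.prod_range_succ, ← powProd, ← powProd,
      pow_succ', ← hh, inv_pow, ← hh, mul_inv_rev]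
    replace ih := congrArg Additive.ofMul ih
    replace e₁ := congrArg Additive.ofMul e₁
    replace e₂ := congrArg Additive.ofMul e₂
    replace e₃ := congrArg Additive.ofMul e₃
    replace e₄ := congrArg Additive.ofMul e₄
    apply Additive.ofMul.injective
    simp only [ofMul_mul, ofMul_div, ofMul_one] at ih e₁ e₂ e₃ e₄ ⊢
    linear_combination (norm := abel) ih - e₁ + e₂ + e₃ - e₄

end IsNormalized3Cocycle

end Cocycle

section SqrtExtension

variable {G : Type*} [Group G] {ω : G → G → G → ℂˣ} {z : G}

theorem IsNormalized3Cocycle.theta_involution_mul (hω : IsNormalized3Cocycle ω)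
    (hz : ∀ g, g * z = z * g) (hz2 : z * z = 1) (g h : G) :
    theta ω g z z * theta ω h z z * (theta ω z g h * theta ω z g h) = theta ω (g * h) z z := by
  have e := hω.theta_mul_theta (hz g) (hz g) (hz h) (hz h)
  rwa [hz2, hω.gam_one, gam_eq_theta ω (hz g) (hz h), mul_one] at e

theorem IsNormalized3Cocycle.theta_involution_self_mul_self (hω : IsNormalized3Cocycle ω)
    (hz2 : z * z = 1) : theta ω z z z * theta ω z z z = 1 := by
  have e := hω.mul_self_eq_one z
  rw [inv_eq_of_mul_eq_one_left hz2] at e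
  rw [theta_self_left ω rfl, e]

theorem theta_mul_theta_comm (ω : G → G → G → ℂˣ) {x y x' : G} (h : x * y = y * x')
    (hz : ∀ g, g * z = z * g) :
    theta ω x z y * theta ω z x y = theta ω x y z * theta ω z y x' := by
  rw [theta_eq ω (hz x) h, theta_eq ω h (hz x'), theta_eq ω (hz x).symm (hz y).symm,
    theta_eq ω (hz y).symm (hz x').symm]
  apply Additive.ofMul.injective
  simp only [ofMul_mul, ofMul_div]
  abel

/-- The pairs `(g, c)` with `c² = θ_g(z,z)`, multiplied by `(g, c)(h, d) = (gh, c d θ_z(g,h))`. -/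
@[ext]
structure SqrtExtension (hω : IsNormalized3Cocycle ω) (hz : ∀ g, g * z = z * g)
    (hz2 : z * z = 1) where
  fst : G
  snd : ℂˣ
  sq : snd * snd = theta ω fst z z

namespace SqrtExtension

variable {hω : IsNormalized3Cocycle ω} {hz : ∀ g, g * z = z * g} {hz2 : z * z = 1}

instance : Mul (SqrtExtension hω hz hz2) where
  mul k l := ⟨k.fst * l.fst, k.snd * l.snd * theta ω z k.fst l.fst, by
    rw [← hω.theta_involution_mul hz hz2, ← k.sq, ← l.sq, mul_mul_mul_comm,
      mul_mul_mul_comm k.snd]⟩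

instance : One (SqrtExtension hω hz hz2) where
  one := ⟨1, 1, by rw [hω.theta_one_left, mul_one]⟩

instance : Inv (SqrtExtension hω hz hz2) where
  inv k := ⟨k.fst⁻¹, (k.snd * theta ω z k.fst⁻¹ k.fst)⁻¹, by
    have e := hω.theta_involution_mul hz hz2 k.fst⁻¹ k.fst
    rw [inv_mul_cancel, hω.theta_one_left, ← k.sq, mul_assoc, ← mul_mul_mul_comm] at e
    rw [← mul_inv, inv_eq_of_mul_eq_one_left e]⟩

theorem fst_mul (k l : SqrtExtension hω hz hz2) : (k * l).fst = k.fst * l.fst := rfl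

theorem snd_mul (k l : SqrtExtension hω hz hz2) :
    (k * l).snd = k.snd * l.snd * theta ω z k.fst l.fst := rfl

theorem fst_one : (1 : SqrtExtension hω hz hz2).fst = 1 := rfl

theorem snd_one : (1 : SqrtExtension hω hz hz2).snd = 1 := rfl

instance : Group (SqrtExtension hω hz hz2) :=
  Group.ofLeftAxioms
    (fun k l m => SqrtExtension.ext (mul_assoc _ _ _) (by
      have e := hω.theta_cocycle (hz k.fst).symm (hz l.fst).symm (hz m.fst).symm
      simp only [snd_mul, fst_mul]
      calc _ = k.snd * l.snd * m.snd * (theta ω z k.fst l.fst *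
              theta ω z (k.fst * l.fst) m.fst) := by
            simp only [mul_left_comm, mul_comm]
        _ = _ := by rw [e]; simp only [mul_left_comm, mul_comm]))
    (fun k => SqrtExtension.ext (one_mul _) (by
      rw [snd_mul, fst_one, snd_one, hω.theta_one_mid, one_mul, mul_one]))
    (fun k => SqrtExtension.ext (inv_mul_cancel _) (by
      rw [snd_mul, mul_assoc]
      exact inv_mul_cancel _))

/-- The projection `(g, c) ↦ g`. -/
def proj : SqrtExtension hω hz hz2 →* G where
  toFun := fst
  map_one' := rfl
  map_mul' _ _ := rfl

/-- The element `(1, -1)`. -/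
def negOne : SqrtExtension hω hz hz2 := ⟨1, -1, by rw [hω.theta_one_left, neg_mul_neg, mul_one]⟩

theorem negOne_ne_one : (negOne : SqrtExtension hω hz hz2) ≠ 1 := fun h => by
  have := congrArg (fun k => (k.snd : ℂ)) h
  norm_num [negOne, snd_one] at this

theorem mul_negOne (k : SqrtExtension hω hz hz2) : (k * negOne).snd = - k.snd := by
  rw [snd_mul]
  simp [negOne, hω.theta_one_right]

theorem proj_surjective :
    Function.Surjective (proj : SqrtExtension hω hz hz2 →* G) := fun g => by
  obtain ⟨c, hc⟩ := IsAlgClosed.exists_pow_nat_eq ((theta ω g z z : ℂˣ) : ℂ) zero_lt_two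
  have hc0 : c ≠ 0 := by
    rintro rfl
    exact (theta ω g z z).ne_zero (by rw [← hc]; norm_num)
  exact ⟨⟨g, Units.mk0 c hc0, Units.ext (by rw [← hc, pow_two]; rfl)⟩, rfl⟩

theorem eq_or_eq_mul_negOne {k l : SqrtExtension hω hz hz2} (h : k.fst = l.fst) :
    k = l ∨ k = l * negOne := by
  have e : k.snd * k.snd = l.snd * l.snd := by rw [k.sq, l.sq, h]
  rcases mul_self_eq_mul_self_iff.1 (congrArg Units.val e) with e | e
  · exact .inl (SqrtExtension.ext h (Units.ext e))
  · exact .inr (SqrtExtension.ext (h.trans (mul_one _).symm)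
      ((Units.ext e).trans (mul_negOne l).symm))

theorem mul_self_of_proj_eq {k : SqrtExtension hω hz hz2} (h : proj k = z) : k * k = 1 := by
  have h' : k.fst = z := h
  refine SqrtExtension.ext ?_ ?_
  · rw [fst_mul, h', hz2, fst_one]
  · rw [snd_mul, k.sq, h', hω.theta_involution_self_mul_self hz2, snd_one]

theorem conj_eq_inv {k l : SqrtExtension hω hz hz2} (hk : z ∈ Submonoid.powers (proj k))
    (h : proj (l⁻¹ * k * l) = proj k⁻¹) : l⁻¹ * k * l = k⁻¹ := by
  obtain ⟨n, hn⟩ := hk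
  set p := l⁻¹ * k * l with hp
  replace hn : k.fst ^ n = z := hn
  have hf : p.fst = k.fst⁻¹ := h
  have hc : k.fst * l.fst = l.fst * k.fst⁻¹ := by
    rw [← hf, ← fst_mul, ← fst_mul, hp]
    congr 1
    group
  have hs : k.snd * l.snd * theta ω z k.fst l.fst = l.snd * p.snd * theta ω z l.fst k.fst⁻¹ := by
    rw [← hf, ← snd_mul, ← snd_mul, hp]
    congr 1
    group
  have e₁ := hω.theta_pow_mul_powProd hc n
  have e₂ := hω.powProd_inv k.fst n
  have hzi : z⁻¹ = z := inv_eq_of_mul_eq_one_left hz2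
  rw [hn, hzi, gam_eq_theta ω (hz _) (hz _), ← k.sq] at e₂
  rw [inv_pow, hn, hzi] at e₁
  have e₃ := theta_mul_theta_comm ω hc hz
  refine eq_inv_of_mul_eq_one_right (SqrtExtension.ext ?_ ?_)
  · rw [fst_mul, hf, mul_inv_cancel, fst_one]
  · rw [snd_mul, snd_one, hf]
    replace hs := congrArg Additive.ofMul hs
    replace e₁ := congrArg Additive.ofMul e₁
    replace e₂ := congrArg Additive.ofMul e₂
    replace e₃ := congrArg Additive.ofMul e₃
    apply Additive.ofMul.injective
    simp only [ofMul_mul, ofMul_one] at hs e₁ e₂ e₃ ⊢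
    linear_combination (norm := abel) e₃ - hs - e₁ - e₂

theorem exists_sign [Finite G] (hz1 : z ≠ 1) (huniq : ∀ w : G, w * w = 1 → w ≠ 1 → w = z) :
    ∃ V : SqrtExtension hω hz hz2 →* ℤˣ, V negOne = -1 := by
  refine exists_sign_of_unique_involution (π := proj) hz2 hz1 huniq proj_surjective negOne_ne_one
    (SqrtExtension.ext (mul_one 1) ?_) rfl (fun k hk => ?_) (fun k => mul_self_of_proj_eq)
    (fun k l hk => conj_eq_inv (mem_powers_iff_mem_zpowers.2 hk))
  · rw [mul_negOne, snd_one]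
    exact neg_neg 1
  · rw [← one_mul negOne]
    exact eq_or_eq_mul_negOne hk

/-- A sign on the extension which is `-1` at `(1, -1)` makes `c⁻¹` descend to a function on `G`. -/
theorem exists_function_of_sign {V : SqrtExtension hω hz hz2 →* ℤˣ} (hV : V negOne = -1) :
    ∃ τ : G → ℂˣ, ∀ k : SqrtExtension hω hz hz2,
      τ k.fst = Units.map (Int.castRingHom ℂ).toMonoidHom (V k) / k.snd := by
  choose s hs using proj_surjective (hω := hω) (hz := hz) (hz2 := hz2)
  refine ⟨fun g => Units.map (Int.castRingHom ℂ).toMonoidHom (V (s g)) / (s g).snd, fun k => ?_⟩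
  rcases eq_or_eq_mul_negOne (k := s k.fst) (l := k) (hs k.fst) with h | h
  · simp only [h]
  · have hn : Units.map (Int.castRingHom ℂ).toMonoidHom (-1) = (-1 : ℂˣ) := Units.ext (by simp)
    dsimp only
    rw [h, mul_negOne, map_mul, map_mul, hV, hn, mul_neg_one, neg_div_neg_eq]

end SqrtExtension

theorem exists_theta_trivialization [Finite G] (hz2 : z * z = 1) (hz1 : z ≠ 1)
    (huniq : ∀ w : G, w * w = 1 → w ≠ 1 → w = z) (hω : IsNormalized3Cocycle ω) :
    ∃ τ : G → ℂˣ, τ 1 = 1 ∧ (∀ x y, theta ω z x y = τ x * τ y / τ (x * y)) ∧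
      ∀ g, theta ω g z z * (τ g * τ g) = 1 := by
  have hz : ∀ g, g * z = z * g := fun g => by
    rw [← mul_inv_eq_iff_eq_mul]
    refine huniq _ (by rw [conj_mul, hz2, mul_one, mul_inv_cancel]) fun h => hz1 ?_
    simpa using h
  obtain ⟨V, hV⟩ := SqrtExtension.exists_sign (hω := hω) (hz := hz) (hz2 := hz2) hz1 huniq
  obtain ⟨τ, hτ⟩ := SqrtExtension.exists_function_of_sign hV
  refine ⟨τ, ?_, fun x y => ?_, fun g => ?_⟩
  · have := hτ 1
    rwa [SqrtExtension.fst_one, SqrtExtension.snd_one, map_one, map_one, div_one] at this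
  · obtain ⟨k, rfl⟩ := SqrtExtension.proj_surjective (hω := hω) (hz := hz) (hz2 := hz2) x
    obtain ⟨l, rfl⟩ := SqrtExtension.proj_surjective (hω := hω) (hz := hz) (hz2 := hz2) y
    change _ = τ k.fst * τ l.fst / τ (k * l).fst
    rw [hτ, hτ, hτ, map_mul, map_mul, div_mul_div_comm, div_div_div_cancel_left,
      SqrtExtension.snd_mul, mul_div_cancel_left]
    rfl
  · obtain ⟨k, rfl⟩ := SqrtExtension.proj_surjective (hω := hω) (hz := hz) (hz2 := hz2) g
    change theta ω k.fst z z * (τ k.fst * τ k.fst) = 1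
    rw [hτ, ← k.sq, div_mul_div_comm, mul_div_cancel, ← map_mul, Int.units_mul_self, map_one]

end SqrtExtension

theorem unique_involution_admissible {G : Type*} [Group G] [Finite G]
    (z : G) (hz2 : z * z = 1) (hz1 : z ≠ 1)
    (huniq : ∀ w : G, w * w = 1 → w ≠ 1 → w = z)
    (ω : G → G → G → ℂˣ) (hω : IsNormalized3Cocycle ω) :
    ∃ (τ : ↥(Subgroup.zpowers z) → G → ℂˣ)
      (ν : ↥(Subgroup.zpowers z) → (G →* ℂˣ)),
      IsAdmissiblePair ω (Subgroup.zpowers z) τ ν := by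
  classical
  obtain ⟨τ, hτ1, hτ, hτ2⟩ := exists_theta_trivialization hz2 hz1 huniq hω
  have hA : ∀ a : Subgroup.zpowers z, a = 1 ∨ (a : G) = z := by
    rintro ⟨_, n, rfl⟩
    have hz : z ^ (2 : ℤ) = 1 := by rw [zpow_ofNat, pow_two, hz2]
    rcases Int.even_or_odd' n with ⟨m, rfl | rfl⟩
    · exact .inl (Subtype.ext (by simp [zpow_mul, hz]))
    · exact .inr (by simp [zpow_add, zpow_mul, hz])
  have hne : ∀ a : Subgroup.zpowers z, (a : G) = z → a ≠ 1 := by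
    rintro a ha rfl
    exact hz1 ha.symm
  refine ⟨fun a => if a = 1 then 1 else τ, 1, fun x => by simp, fun a => ?_, fun a x y => ?_, rfl,
    fun a b g => ?_⟩
  · dsimp only
    split_ifs
    exacts [rfl, hτ1]
  · rcases hA a with rfl | ha
    · simp [hω.theta_one_left]
    · simp only [if_neg (hne a ha), ha, hτ]
  · simp only [Pi.one_apply, MonoidHom.one_apply, mul_one, div_one]
    rcases hA a with rfl | ha
    · simp [hω.theta_one_mid]
    rcases hA b with rfl | hb
    · simp [hω.theta_one_right]
    have hab : a * b = 1 := Subtype.ext (by simp [ha, hb, hz2])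
    simp only [if_neg (hne a ha), if_neg (hne b hb), hab, if_true, ha, hb, Pi.one_apply, div_one,
      hτ2]
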